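/- arXiv:math/9809170 — 2 statements merged into one kernel-verified Lean document; each statement's English description precedes it below -/
import Mathlib

section
/- Let F̂ be a closed R-matrix satisfying the Yang–Baxter equation, with associated matrix D. Then: (i) Tr_F(2) F̂₁ = I; (ii) F̂₁ D₁ D₂ = D₁ D₂ F̂₁ on V⊗V; and (iii) for any unital associative k-algebra A and any N×N matrix X over A (N = dim V), Tr_F(2)(F̂₁^{±1} X₁ F̂₁^{∓1}) = I · Tr_F X, where X₁ denotes X placed in the first tensor factor. -/
/-! Common definitions for quantum matrix algebras `M(R̂,F̂)` in the sense of
Isaev–Ogievetsky–Pyatov, "On quantum matrix algebras satisfying the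
Cayley-Hamilton-Newton identities".

We model operators on `V^{⊗m}` (where `dim V = N`) as matrices indexed by
multi-indices `Fin m → Fin N`; entries are taken in a (possibly
noncommutative) unital associative algebra `A` over a field `K`.
Sites (tensor factors) are numbered starting from `0`, so the paper's
`X_i` is `site m (i-1) X`, and the paper's `M_{\overline{k}}` is
`Mbar m F F⁻¹ M (k-1)`. -/

namespace CHN

noncomputable section

/-- Operators on `V^{⊗m}` (`dim V = N`) with entries in a ring `A`. -/
abbrev Op (N : ℕ) (A : Type*) [Ring A] (m : ℕ) :=
  Matrix (Fin m → Fin N) (Fin m → Fin N) A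

/-- Operators on `V ⊗ V`. -/
abbrev M2 (N : ℕ) (A : Type*) [Ring A] :=
  Matrix (Fin N × Fin N) (Fin N × Fin N) A

/-- `site m i X` places the two-site operator `X` at the (0-based) tensor
factors `i, i+1` of `V^{⊗m}`, acting as the identity elsewhere.  In the
paper's 1-based notation, `X_i = site m (i-1) X`.  (Out of range it is the
identity.) -/
def site {A : Type*} [Ring A] {N : ℕ} (m i : ℕ) (X : M2 N A) : Op N A m :=
  fun a b =>
    if h : i + 1 < m then
      X (a ⟨i, Nat.lt_of_succ_lt h⟩, a ⟨i + 1, h⟩)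
          (b ⟨i, Nat.lt_of_succ_lt h⟩, b ⟨i + 1, h⟩) *
        (if ∀ j : Fin m, (j : ℕ) ≠ i → (j : ℕ) ≠ i + 1 → a j = b j then 1 else 0)
    else if a = b then 1 else 0

/-- `site1 m i X` places the one-site operator `X` at the (0-based) factor `i`. -/
def site1 {A : Type*} [Ring A] {N : ℕ} (m i : ℕ) (X : Matrix (Fin N) (Fin N) A) :
    Op N A m :=
  fun a b =>
    if h : i < m then
      X (a ⟨i, h⟩) (b ⟨i, h⟩) *
        (if ∀ j : Fin m, (j : ℕ) ≠ i → a j = b j then 1 else 0)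
    else if a = b then 1 else 0

/-- `chain m X i l = X_i X_{i+1} ⋯ X_{i+l-1}` (0-based sites, `l` factors); in
the paper's 1-based notation this is `X_{i+1 → i+l}`. -/
def chain {A : Type*} [Ring A] {N : ℕ} (m : ℕ) (X : M2 N A) (i : ℕ) :
    ℕ → Op N A m
  | 0 => 1
  | l + 1 => chain m X i l * site m (i + l) X

/-- The Yang–Baxter equation `X₁X₂X₁ = X₂X₁X₂` on `V^{⊗3}`. -/
def YB {A : Type*} [Ring A] {N : ℕ} (X : M2 N A) : Prop :=
  site 3 0 X * site 3 1 X * site 3 0 X = site 3 1 X * site 3 0 X * site 3 1 X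

/-- Compatibility of a pair of R-matrices: both Yang–Baxter equations together
with the conditions `R̂₁F̂₂F̂₁ = F̂₂F̂₁R̂₂` and `F̂₁F̂₂R̂₁ = R̂₂F̂₁F̂₂` on `V^{⊗3}`. -/
def Compatible {A : Type*} [Ring A] {N : ℕ} (R F : M2 N A) : Prop :=
  YB R ∧ YB F ∧
    site 3 0 R * site 3 1 F * site 3 0 F = site 3 1 F * site 3 0 F * site 3 1 R ∧
    site 3 0 F * site 3 1 F * site 3 0 R = site 3 1 R * site 3 0 F * site 3 1 F

/-- `Ψ` witnesses closedness of `F̂`:  `Ψ^{af}_{cg} F̂^{gb}_{fd} = δ^a_d δ^b_c`. -/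
def IsClosedPair {A : Type*} [Ring A] {N : ℕ} (F Ψ : M2 N A) : Prop :=
  ∀ a b c d : Fin N,
    (∑ f : Fin N, ∑ g : Fin N, Ψ (a, f) (c, g) * F (g, b) (f, d)) =
      if a = d ∧ b = c then 1 else 0

/-- The matrix `D`, `D^a_b := Ψ^{ac}_{bc}`. -/
def Dmat {A : Type*} [Ring A] {N : ℕ} (Ψ : M2 N A) : Matrix (Fin N) (Fin N) A :=
  fun a b => ∑ c : Fin N, Ψ (a, c) (b, c)

/-- Quantum trace (with weight `D`) over the last tensor factor. -/
def qtr1 {K : Type*} [Field K] {A : Type*} [Ring A] [Algebra K A] {N m : ℕ}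
    (D : Matrix (Fin N) (Fin N) K) (X : Op N A (m + 1)) : Op N A m :=
  fun a b => ∑ c : Fin N, ∑ e : Fin N,
    algebraMap K A (D c e) * X (Fin.snoc a e) (Fin.snoc b c)

/-- Quantum trace over the last `j` tensor factors. -/
def qtrs {K : Type*} [Field K] {A : Type*} [Ring A] [Algebra K A] {N : ℕ}
    (D : Matrix (Fin N) (Fin N) K) (m : ℕ) :
    (j : ℕ) → Op N A (m + j) → Op N A m
  | 0, X => X
  | j + 1, X => qtrs D m j (qtr1 D X)

/-- Full quantum trace `Tr_F(1,…,m)`, with values in `A`. -/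
def qtrAll {K : Type*} [Field K] {A : Type*} [Ring A] [Algebra K A] {N m : ℕ}
    (D : Matrix (Fin N) (Fin N) K) (X : Op N A m) : A :=
  ∑ a : Fin m → Fin N, ∑ b : Fin m → Fin N,
    algebraMap K A (∏ i, D (a i) (b i)) * X b a

/-- Quantum trace of a one-site operator:  `Tr_F X = Tr (D X)`. -/
def trF {K : Type*} [Field K] {A : Type*} [Ring A] [Algebra K A] {N : ℕ}
    (D : Matrix (Fin N) (Fin N) K) (X : Matrix (Fin N) (Fin N) A) : A :=
  ∑ a : Fin N, ∑ b : Fin N, algebraMap K A (D a b) * X b a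

/-- Ordinary partial trace over the last tensor factor. -/
def ptr1 {A : Type*} [Ring A] {N m : ℕ} (X : Op N A (m + 1)) : Op N A m :=
  fun a b => ∑ c : Fin N, X (Fin.snoc a c) (Fin.snoc b c)

/-- Ordinary partial trace over the last `j` tensor factors. -/
def ptrs {A : Type*} [Ring A] {N : ℕ} (m : ℕ) :
    (j : ℕ) → Op N A (m + j) → Op N A m
  | 0, X => X
  | j + 1, X => ptrs m j (ptr1 X)

/-- `Mbar m F Finv M k` is the paper's `M_{\overline{k+1}}` (0-based index `k`):
`M_{\overline{1}} := M₁` and `M_{\overline{k+1}} := F̂_k M_{\overline{k}} F̂_k⁻¹`. -/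
def Mbar {A : Type*} [Ring A] {N : ℕ} (m : ℕ) (F Finv : M2 N A)
    (M : Matrix (Fin N) (Fin N) A) : ℕ → Op N A m
  | 0 => site1 m 0 M
  | k + 1 => site m k F * Mbar m F Finv M k * site m k Finv

/-- `MbarSeg m F Finv M i l = M_{\overline{i+1}} M_{\overline{i+2}} ⋯ M_{\overline{i+l}}`,
the ordered product of `l` consecutive copies starting at 0-based index `i`.
In particular `MbarSeg m F Finv M 0 k = M_{\overline{1}} ⋯ M_{\overline{k}}`. -/
def MbarSeg {A : Type*} [Ring A] {N : ℕ} (m : ℕ) (F Finv : M2 N A)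
    (M : Matrix (Fin N) (Fin N) A) (i : ℕ) : ℕ → Op N A m
  | 0 => 1
  | l + 1 => MbarSeg m F Finv M i l * Mbar m F Finv M (i + l)

/-- The double twist `R̂^{FF} = F̂ (F̂ R̂ F̂⁻¹) F̂⁻¹`. -/
def RFF {K : Type*} [Field K] {N : ℕ} (R F : M2 N K) : M2 N K :=
  F * (F * R * F⁻¹) * F⁻¹

/-- `M` is a matrix of generators of the algebra `M(R̂,F̂)`:
`R̂₁ M_{\overline{1}} M_{\overline{2}} = M_{\overline{1}} M_{\overline{2}} (R̂^{FF})₁`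
on `V ⊗ V`. -/
def IsGenerators {K : Type*} [Field K] {A : Type*} [Ring A] [Algebra K A] {N : ℕ}
    (R F : M2 N K) (M : Matrix (Fin N) (Fin N) A) : Prop :=
  site 2 0 (R.map (algebraMap K A)) *
      MbarSeg 2 (F.map (algebraMap K A)) ((F⁻¹).map (algebraMap K A)) M 0 2 =
    MbarSeg 2 (F.map (algebraMap K A)) ((F⁻¹).map (algebraMap K A)) M 0 2 *
      site 2 0 ((RFF R F).map (algebraMap K A))

/-- Evaluation of a noncommutative polynomial `Y` in `v` variables, substituting
for the variable `x_j` the operator `R̂` placed at the (0-based) sites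
`p+j, p+j+1` of `V^{⊗m}`.  For `p = 0` this is the paper's
`Y^{(v+1)} = Y^{(v+1)}(R̂₁,…,R̂_v)`, and a general `p` gives `Y^{(p+1,v+1)}`. -/
def evalY {K : Type*} [Field K] {A : Type*} [Ring A] [Algebra K A] {N m v : ℕ}
    (R : M2 N A) (p : ℕ) (Y : FreeAlgebra K (Fin v)) : Op N A m :=
  FreeAlgebra.lift K (fun j : Fin v => site m (p + (j : ℕ)) R) Y

/-- `Ustack m R k l = R̂_{l → l+k-1} ⋯ R̂_{2 → k+1} R̂_{1 → k}` (1-based labels):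
the product of `l` descending chains of length `k`. -/
def Ustack {A : Type*} [Ring A] {N : ℕ} (m : ℕ) (R : M2 N A) (k : ℕ) :
    ℕ → Op N A m
  | 0 => 1
  | l + 1 => chain m R l k * Ustack m R k l

/-- The `q`-number `n_q = (qⁿ − q⁻ⁿ)/(q − q⁻¹)`. -/
def qInt {K : Type*} [Field K] (q : K) (n : ℕ) : K :=
  (q ^ n - q⁻¹ ^ n) / (q - q⁻¹)

/-- `R̂` is a Hecke R-matrix for the parameter `q`:  it is invertible, satisfies
the Yang–Baxter equation and the Hecke condition `R̂² = 1 + (q − q⁻¹)R̂`. -/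
def IsHecke {K : Type*} [Field K] {N : ℕ} (q : K) (R : M2 N K) : Prop :=
  IsUnit R ∧ YB R ∧ R * R = 1 + (q - q⁻¹) • R

/-- The `q`-antisymmetrizer `A^{(k)}` built from `R̂`, placed at the (0-based)
tensor factors `p, p+1, …, p+k-1` of `V^{⊗m}`. -/
def qasym {K : Type*} [Field K] {N : ℕ} (q : K) (R : M2 N K) (m p : ℕ) :
    ℕ → Op N K m
  | 0 => 1
  | 1 => 1
  | k + 2 =>
      (qInt q (k + 2))⁻¹ •
        (qasym q R m p (k + 1) *
          (q ^ (k + 1) • (1 : Op N K m) - qInt q (k + 1) • site m (p + k) R) *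
          qasym q R m p (k + 1))

/-- The `q`-symmetrizer `S^{(k)}` built from `R̂`, placed at the (0-based)
tensor factors `p, p+1, …, p+k-1` of `V^{⊗m}`. -/
def qsym {K : Type*} [Field K] {N : ℕ} (q : K) (R : M2 N K) (m p : ℕ) :
    ℕ → Op N K m
  | 0 => 1
  | 1 => 1
  | k + 2 =>
      (qInt q (k + 2))⁻¹ •
        (qsym q R m p (k + 1) *
          (q⁻¹ ^ (k + 1) • (1 : Op N K m) + qInt q (k + 1) • site m (p + k) R) *
          qsym q R m p (k + 1))

/-- The elementary symmetric function
`σ_k(M) = Tr_F(1,…,k)(A^{(k)} M_{\overline{1}}⋯M_{\overline{k}})` (with `σ_0 = 1`). -/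
def sigmaF {K : Type*} [Field K] {A : Type*} [Ring A] [Algebra K A] {N : ℕ}
    (q : K) (R F Ψ : M2 N K) (M : Matrix (Fin N) (Fin N) A) (k : ℕ) : A :=
  qtrAll (Dmat Ψ)
    ((qasym q R k 0 k).map (algebraMap K A) *
      MbarSeg k (F.map (algebraMap K A)) ((F⁻¹).map (algebraMap K A)) M 0 k)

/-- The complete symmetric function
`τ_k(M) = Tr_F(1,…,k)(S^{(k)} M_{\overline{1}}⋯M_{\overline{k}})` (with `τ_0 = 1`). -/
def tauF {K : Type*} [Field K] {A : Type*} [Ring A] [Algebra K A] {N : ℕ}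
    (q : K) (R F Ψ : M2 N K) (M : Matrix (Fin N) (Fin N) A) (k : ℕ) : A :=
  qtrAll (Dmat Ψ)
    ((qsym q R k 0 k).map (algebraMap K A) *
      MbarSeg k (F.map (algebraMap K A)) ((F⁻¹).map (algebraMap K A)) M 0 k)

/-- The power sums `s_k(M) = Tr_F(1,…,k)(R̂_{1→k−1} M_{\overline{1}}⋯M_{\overline{k}})`,
with `s_0 = 1`. -/
def sF {K : Type*} [Field K] {A : Type*} [Ring A] [Algebra K A] {N : ℕ}
    (R F Ψ : M2 N K) (M : Matrix (Fin N) (Fin N) A) : ℕ → A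
  | 0 => 1
  | j + 1 =>
      qtrAll (Dmat Ψ)
        (chain (j + 1) (R.map (algebraMap K A)) 0 j *
          MbarSeg (j + 1) (F.map (algebraMap K A)) ((F⁻¹).map (algebraMap K A)) M 0 (j + 1))

/-- The `(j+1)`-st quantum power of `M`,
`M^{\overline{j+1}} = Tr_F(2,…,j+1)(R̂_{1→j} M_{\overline{1}}⋯M_{\overline{j+1}})`,
as a one-site operator (so `MpowF R F Ψ M 0 = M₁ = M`). -/
def MpowF {K : Type*} [Field K] {A : Type*} [Ring A] [Algebra K A] {N : ℕ}
    (R F Ψ : M2 N K) (M : Matrix (Fin N) (Fin N) A) (j : ℕ) : Op N A 1 :=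
  qtrs (Dmat Ψ) 1 j
    (chain (1 + j) (R.map (algebraMap K A)) 0 j *
      MbarSeg (1 + j) (F.map (algebraMap K A)) ((F⁻¹).map (algebraMap K A)) M 0 (j + 1))

/-- The `(j+1)`-st wedge power of `M`,
`M^{∧(j+1)} = Tr_F(2,…,j+1)(A^{(j+1)} M_{\overline{1}}⋯M_{\overline{j+1}})`. -/
def MwedgeF {K : Type*} [Field K] {A : Type*} [Ring A] [Algebra K A] {N : ℕ}
    (q : K) (R F Ψ : M2 N K) (M : Matrix (Fin N) (Fin N) A) (j : ℕ) : Op N A 1 :=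
  qtrs (Dmat Ψ) 1 j
    ((qasym q R (1 + j) 0 (j + 1)).map (algebraMap K A) *
      MbarSeg (1 + j) (F.map (algebraMap K A)) ((F⁻¹).map (algebraMap K A)) M 0 (j + 1))

/-- The `(j+1)`-st symmetric power of `M`,
`M^{S(j+1)} = Tr_F(2,…,j+1)(S^{(j+1)} M_{\overline{1}}⋯M_{\overline{j+1}})`. -/
def MsymF {K : Type*} [Field K] {A : Type*} [Ring A] [Algebra K A] {N : ℕ}
    (q : K) (R F Ψ : M2 N K) (M : Matrix (Fin N) (Fin N) A) (j : ℕ) : Op N A 1 :=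
  qtrs (Dmat Ψ) 1 j
    ((qsym q R (1 + j) 0 (j + 1)).map (algebraMap K A) *
      MbarSeg (1 + j) (F.map (algebraMap K A)) ((F⁻¹).map (algebraMap K A)) M 0 (j + 1))

/-- `M^{\overline{0}} := q^{-n} n_q Tr_{(2,…,n)}(A^{(n)}) D^{-1}`, with `n = n0 + 1`
(an ordinary, non-quantum, trace over the factors `2,…,n`). -/
def MzeroF {K : Type*} [Field K] {N : ℕ} (q : K) (R Ψ : M2 N K) (n0 : ℕ) :
    Op N K 1 :=
  (q⁻¹ ^ (n0 + 1) * qInt q (n0 + 1)) •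
    (ptrs 1 n0 (qasym q R (1 + n0) 0 (n0 + 1)) * site1 1 0 ((Dmat Ψ)⁻¹))

/-- The generators of the characteristic subalgebra: all elements
`α(Y^{(k)}) = Tr_F(1,…,k)(Y^{(k)} M_{\overline{1}}⋯M_{\overline{k}})`, `k ≥ 1`. -/
def charSet {K : Type*} [Field K] {A : Type*} [Ring A] [Algebra K A] {N : ℕ}
    (R F Ψ : M2 N K) (M : Matrix (Fin N) (Fin N) A) : Set A :=
  { x : A | ∃ (v : ℕ) (Y : FreeAlgebra K (Fin v)),
      x = qtrAll (Dmat Ψ)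
        (evalY (R.map (algebraMap K A)) 0 Y *
          MbarSeg (v + 1) (F.map (algebraMap K A)) ((F⁻¹).map (algebraMap K A)) M 0 (v + 1)) }

end

open scoped Kronecker

lemma sum_sum_mul_sum_sum_comm {R ι : Type*} [CommSemiring R] [Fintype ι]
    (f g : ι → ι → R) (w : ι → ι → ι → ι → R) :
    ∑ x, ∑ z, f x z * ∑ c, ∑ e, g c e * w c e x z =
      ∑ c, ∑ e, g c e * ∑ x, ∑ z, f x z * w c e x z := by
  simp only [Finset.mul_sum]
  refine Finset.sum_comm_cycle.trans (Finset.sum_congr rfl fun c _ =>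
    Finset.sum_comm_cycle.trans (Finset.sum_congr rfl fun e _ =>
      Finset.sum_congr rfl fun x _ => Finset.sum_congr rfl fun z _ => ?_))
  ring

section PartialTrace

variable {R m n : Type*} [CommRing R] [Fintype m] [Fintype n]

/-- Trace over the right tensor factor, weighted by `D`. -/
def weightedTraceRight (D : Matrix n n R) (M : Matrix (m × n) (m × n) R) : Matrix m m R :=
  fun a b => ∑ c, ∑ e, D c e * M (a, e) (b, c)

lemma weightedTraceRight_kronecker_mul [DecidableEq n] (D : Matrix n n R) (P : Matrix m m R)
    (M : Matrix (m × n) (m × n) R) :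
    weightedTraceRight D (P ⊗ₖ (1 : Matrix n n R) * M) = P * weightedTraceRight D M := by
  ext a b
  simp only [weightedTraceRight, Matrix.mul_apply, Fintype.sum_prod_type,
    Matrix.kroneckerMap_apply, Matrix.one_apply, mul_ite, mul_one, mul_zero, ite_mul, zero_mul,
    Finset.sum_ite_eq, Finset.mem_univ, if_true, Finset.mul_sum]
  rw [Finset.sum_comm_cycle]
  refine Finset.sum_congr rfl fun x _ => Finset.sum_congr rfl fun c _ =>
    Finset.sum_congr rfl fun e _ => ?_
  ring

lemma weightedTraceRight_mul_kronecker [DecidableEq n] (D : Matrix n n R) (P : Matrix m m R)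
    (M : Matrix (m × n) (m × n) R) :
    weightedTraceRight D (M * P ⊗ₖ (1 : Matrix n n R)) = weightedTraceRight D M * P := by
  ext a b
  simp only [weightedTraceRight, Matrix.mul_apply, Fintype.sum_prod_type,
    Matrix.kroneckerMap_apply, Matrix.one_apply, mul_ite, mul_one, mul_zero,
    Finset.sum_ite_eq', Finset.mem_univ, if_true, Finset.mul_sum, Finset.sum_mul]
  rw [Finset.sum_comm_cycle]
  refine Finset.sum_congr rfl fun x _ => Finset.sum_congr rfl fun c _ =>
    Finset.sum_congr rfl fun e _ => ?_
  ring

lemma trace_kronecker_mul (C : Matrix m m R) (D : Matrix n n R)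
    (M : Matrix (m × n) (m × n) R) :
    (C ⊗ₖ D * M).trace = (C * weightedTraceRight D M).trace := by
  simp only [Matrix.trace, Matrix.diag, weightedTraceRight, Matrix.mul_apply,
    Fintype.sum_prod_type, Matrix.kroneckerMap_apply, Finset.mul_sum, mul_assoc]
  exact Finset.sum_congr rfl fun a _ => Finset.sum_comm

end PartialTrace

section Reindex

variable {A : Type*} [Ring A] {N : ℕ}

/-- Multi-indices for `V^{⊗3}`, grouped as `(V ⊗ V) ⊗ V`. -/
def finThreeIndex (N : ℕ) : ((Fin N × Fin N) × Fin N) ≃ (Fin 3 → Fin N) where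
  toFun p := ![p.1.1, p.1.2, p.2]
  invFun f := ((f 0, f 1), f 2)
  left_inv _ := rfl
  right_inv f := by ext i; fin_cases i <;> rfl

/-- Multi-indices for `V ⊗ V`. -/
def finTwoIndex (N : ℕ) : (Fin N × Fin N) ≃ (Fin 2 → Fin N) where
  toFun p := ![p.1, p.2]
  invFun f := (f 0, f 1)
  left_inv _ := rfl
  right_inv f := by ext i; fin_cases i <;> rfl

@[simp]
lemma finThreeIndex_apply (p : (Fin N × Fin N) × Fin N) :
    finThreeIndex N p = ![p.1.1, p.1.2, p.2] := rfl

@[simp]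
lemma finTwoIndex_apply (p : Fin N × Fin N) : finTwoIndex N p = ![p.1, p.2] := rfl

lemma site_two_submatrix (X : M2 N A) :
    (site 2 0 X).submatrix (finTwoIndex N) (finTwoIndex N) = X := by
  ext ⟨a, b⟩ ⟨c, d⟩
  simp [site, Fin.forall_fin_two]

lemma site1_two_zero_submatrix (X : Matrix (Fin N) (Fin N) A) :
    (site1 2 0 X).submatrix (finTwoIndex N) (finTwoIndex N) = X ⊗ₖ (1 : Matrix _ _ A) := by
  ext ⟨a, b⟩ ⟨c, d⟩
  simp [site1, Fin.forall_fin_two, Matrix.one_apply]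

lemma site1_two_one_submatrix (X : Matrix (Fin N) (Fin N) A) :
    (site1 2 1 X).submatrix (finTwoIndex N) (finTwoIndex N) = (1 : Matrix _ _ A) ⊗ₖ X := by
  ext ⟨a, b⟩ ⟨c, d⟩
  simp [site1, Fin.forall_fin_two, Matrix.one_apply]

lemma site_three_zero_submatrix (X : M2 N A) :
    (site 3 0 X).submatrix (finThreeIndex N) (finThreeIndex N) = X ⊗ₖ (1 : Matrix _ _ A) := by
  ext ⟨⟨a, b⟩, c⟩ ⟨⟨d, e⟩, f⟩
  simp [site, Fin.forall_fin_succ, Matrix.one_apply]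

/-- `X` acting on the last two factors of `(V ⊗ V) ⊗ V`. -/
def actRight (X : M2 N A) : Matrix ((Fin N × Fin N) × Fin N) ((Fin N × Fin N) × Fin N) A :=
  ((1 : Matrix (Fin N) (Fin N) A) ⊗ₖ X).submatrix
    (Equiv.prodAssoc _ _ _) (Equiv.prodAssoc _ _ _)

lemma site_three_one_submatrix (X : M2 N A) :
    (site 3 1 X).submatrix (finThreeIndex N) (finThreeIndex N) = actRight X := by
  ext ⟨⟨a, b⟩, c⟩ ⟨⟨d, e⟩, f⟩
  simp [site, actRight, Fin.forall_fin_succ, Matrix.one_apply]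

end Reindex

section Closed

variable {K : Type*} [Field K] {N : ℕ}

lemma actRight_mul (X Y : M2 N K) : actRight (X * Y) = actRight X * actRight Y := by
  rw [actRight, actRight, actRight, Matrix.submatrix_mul_equiv, ← Matrix.mul_kronecker_mul,
    one_mul]

lemma actRight_one : actRight (1 : M2 N K) = 1 := by
  rw [actRight, Matrix.one_kronecker_one, Matrix.submatrix_one_equiv]

lemma YB.kronecker {F : M2 N K} (h : YB F) :
    F ⊗ₖ (1 : Matrix (Fin N) (Fin N) K) * actRight F * F ⊗ₖ (1 : Matrix (Fin N) (Fin N) K) =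
      actRight F * F ⊗ₖ (1 : Matrix (Fin N) (Fin N) K) * actRight F := by
  have := congrArg (fun M => M.submatrix (finThreeIndex N) (finThreeIndex N)) h
  simpa only [← Matrix.submatrix_mul_equiv _ _ _ (finThreeIndex N) _,
    site_three_zero_submatrix, site_three_one_submatrix] using this

lemma qtr1_apply_finTwo (D : Matrix (Fin N) (Fin N) K) {A : Type*} [Ring A] [Algebra K A]
    (X : Op N A 2) (a b : Fin 1 → Fin N) :
    qtr1 D X a b = ∑ c, ∑ e, algebraMap K A (D c e) *
      X.submatrix (finTwoIndex N) (finTwoIndex N) (a 0, e) (b 0, c) := by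
  have key (a : Fin 1 → Fin N) (e : Fin N) :
      (Fin.snoc a e : Fin 2 → Fin N) = finTwoIndex N (a 0, e) := by
    ext i; fin_cases i <;> rfl
  simp only [qtr1, Matrix.submatrix_apply]
  refine Finset.sum_congr rfl fun c _ => Finset.sum_congr rfl fun e _ => ?_
  rw [← key, ← key]

/-- The two-sided form of closedness. -/
lemma IsClosedPair.swap {F Ψ : M2 N K} (h : IsClosedPair F Ψ) (f g f' g' : Fin N) :
    ∑ d, ∑ b, F (g, b) (f, d) * Ψ (d, f') (b, g') = if f = f' ∧ g = g' then 1 else 0 := by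
  have h1 : (Matrix.of fun x y : Fin N × Fin N => Ψ (x.1, y.1) (x.2, y.2)) *
      (Matrix.of fun x y : Fin N × Fin N => F (x.2, y.2) (x.1, y.1)) = 1 := by
    ext ⟨a, c⟩ ⟨d, b⟩
    simp only [Matrix.mul_apply, Fintype.sum_prod_type, Matrix.of_apply, Matrix.one_apply]
    rw [h]
    simp only [Prod.mk.injEq, eq_comm (a := b)]
  rw [mul_eq_one_comm] at h1
  have h2 := congrFun (congrFun h1 (f, g)) (f', g')
  simpa only [Matrix.mul_apply, Fintype.sum_prod_type, Matrix.of_apply, Matrix.one_apply,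
    Prod.mk.injEq] using h2

lemma IsClosedPair.weightedTraceRight_eq_one {F Ψ : M2 N K} (h : IsClosedPair F Ψ) :
    weightedTraceRight (Dmat Ψ) F = 1 := by
  ext a b
  have h1 : ∑ x, ∑ d, ∑ e, F (a, e) (b, d) * Ψ (d, x) (e, x) = if a = b then 1 else 0 := by
    simp only [h.swap, ite_and, Finset.sum_ite_eq, Finset.mem_univ, if_true]
  simp only [weightedTraceRight, Dmat, Finset.sum_mul, Matrix.one_apply, ← h1]
  rw [Finset.sum_comm_cycle]
  simp only [mul_comm]

/-- A tensor is determined by its contractions with the components of a closed matrix. -/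
lemma IsClosedPair.contract {F Ψ : M2 N K} (h : IsClosedPair F Ψ) (T : Fin N → Fin N → K)
    (α γ : Fin N) :
    ∑ f, ∑ g, Ψ (α, f) (γ, g) * ∑ b, ∑ d, F (g, b) (f, d) * T b d = T γ α := by
  have h1 : ∑ b, ∑ d, (∑ f, ∑ g, Ψ (α, f) (γ, g) * F (g, b) (f, d)) * T b d = T γ α := by
    simp only [h α _ γ _, ite_and, ite_mul, one_mul, zero_mul]
    simp
  rw [← h1]
  simp only [Finset.mul_sum, Finset.sum_mul]
  refine Finset.sum_comm_cycle.trans (Finset.sum_congr rfl fun b _ =>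
    Finset.sum_comm_cycle.trans (Finset.sum_congr rfl fun d _ =>
      Finset.sum_congr rfl fun f _ => Finset.sum_congr rfl fun g _ => ?_))
  ring

lemma weightedTraceRight_actRight (D : Matrix (Fin N) (Fin N) K) (X : M2 N K)
    (h : weightedTraceRight D X = 1) : weightedTraceRight D (actRight X) = 1 := by
  ext ⟨a, p⟩ ⟨b, q⟩
  have := congrFun (congrFun h p) q
  simp only [weightedTraceRight] at this
  simp only [weightedTraceRight, actRight, Matrix.submatrix_apply, Equiv.prodAssoc_apply,
    Matrix.kroneckerMap_apply, Matrix.one_apply, Prod.mk.injEq, ite_and] at this ⊢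
  split_ifs at this ⊢ <;> simp_all

lemma actRight_mul_kronecker_mul_actRight (P Q F : M2 N K) (a b c p q e : Fin N) :
    (actRight P * F ⊗ₖ (1 : Matrix (Fin N) (Fin N) K) * actRight Q) ((a, p), e) ((b, q), c) =
      ∑ x, ∑ z, F (a, x) (b, z) * ∑ y, P (p, e) (x, y) * Q (z, y) (q, c) := by
  simp only [Matrix.mul_apply, actRight, Matrix.submatrix_apply, Equiv.prodAssoc_apply,
    Matrix.kroneckerMap_apply, Matrix.one_apply, Fintype.sum_prod_type, mul_ite, ite_mul,
    mul_one, mul_zero, one_mul, zero_mul, Finset.sum_ite_irrel, Finset.sum_const_zero,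
    Finset.sum_ite_eq, Finset.sum_ite_eq', Finset.mem_univ, if_true, Finset.sum_mul,
    Finset.mul_sum]
  refine Finset.sum_comm_cycle.trans (Finset.sum_congr rfl fun x _ =>
    Finset.sum_congr rfl fun z _ => Finset.sum_congr rfl fun y _ => ?_)
  ring

/-- Conjugating `F₁` by an invertible `P₂` with inverse `Q₂`, and tracing over the third factor:
if the result is trivial, then the same holds for every one-site operator. -/
lemma IsClosedPair.sum_conj {F Ψ P Q : M2 N K} (h : IsClosedPair F Ψ)
    (hPQ : weightedTraceRight (Dmat Ψ)
      (actRight P * F ⊗ₖ (1 : Matrix (Fin N) (Fin N) K) * actRight Q) = 1)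
    (p q x z : Fin N) :
    ∑ c, ∑ e, Dmat Ψ c e * ∑ y, P (p, e) (x, y) * Q (z, y) (q, c) =
      if p = q then Dmat Ψ z x else 0 := by
  set T : Fin N → Fin N → K := fun x z =>
    ∑ c, ∑ e, Dmat Ψ c e * ∑ y, P (p, e) (x, y) * Q (z, y) (q, c) with hT
  have key (a b : Fin N) : ∑ x, ∑ z, F (a, x) (b, z) * T x z =
      if a = b ∧ p = q then 1 else 0 := by
    have := congrFun (congrFun hPQ (a, p)) (b, q)
    simp only [Matrix.one_apply, Prod.mk.injEq] at this
    rw [← this]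
    simp only [hT, weightedTraceRight, actRight_mul_kronecker_mul_actRight]
    exact sum_sum_mul_sum_sum_comm _ _ _
  have := h.contract T z x
  simp only [key] at this
  change T x z = _
  rw [← this]
  split_ifs with hpq <;> simp [hpq, Dmat]

lemma YB.weightedTraceRight_conj {F Ψ : M2 N K} (hF : IsUnit F) (hYB : YB F)
    (hΨ : IsClosedPair F Ψ) :
    weightedTraceRight (Dmat Ψ)
        (actRight F * F ⊗ₖ (1 : Matrix (Fin N) (Fin N) K) * actRight F⁻¹) = 1 ∧
      weightedTraceRight (Dmat Ψ)
        (actRight F⁻¹ * F ⊗ₖ (1 : Matrix (Fin N) (Fin N) K) * actRight F) = 1 := by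
  have hdet := (Matrix.isUnit_iff_isUnit_det F).mp hF
  have hFG := Matrix.mul_nonsing_inv F hdet
  have hGF := Matrix.nonsing_inv_mul F hdet
  set G := F⁻¹
  set f := F ⊗ₖ (1 : Matrix (Fin N) (Fin N) K) with hf
  set g := G ⊗ₖ (1 : Matrix (Fin N) (Fin N) K) with hg
  have hfg : f * g = 1 := by
    rw [hf, hg, ← Matrix.mul_kronecker_mul, hFG, one_mul, Matrix.one_kronecker_one]
  have hgf : g * f = 1 := by
    rw [hf, hg, ← Matrix.mul_kronecker_mul, hGF, one_mul, Matrix.one_kronecker_one]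
  have hsFG : actRight F * actRight G = 1 := by rw [← actRight_mul, hFG, actRight_one]
  have hsGF : actRight G * actRight F = 1 := by rw [← actRight_mul, hGF, actRight_one]
  have hyb : f * actRight F * f = actRight F * f * actRight F := hYB.kronecker
  have htr := weightedTraceRight_actRight _ _ hΨ.weightedTraceRight_eq_one
  constructor
  · have : actRight F * f * actRight G = g * (actRight F * f) := by
      calc _ = g * (f * actRight F * f) * actRight G := by
              simp only [← mul_assoc, hgf, one_mul]
        _ = _ := by rw [hyb]; simp only [mul_assoc, hsFG, mul_one]
    rw [this, hg, hf, weightedTraceRight_kronecker_mul, weightedTraceRight_mul_kronecker, htr,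
      one_mul, hGF]
  · have : actRight G * f * actRight F = f * (actRight F * g) := by
      calc _ = actRight G * (actRight F * f * actRight F) * g := by
              rw [← hyb]; simp only [mul_assoc, hfg, mul_one]
        _ = _ := by simp only [← mul_assoc, hsGF, one_mul]
    rw [this, hg, hf, weightedTraceRight_kronecker_mul, weightedTraceRight_mul_kronecker, htr,
      one_mul, hFG]

lemma map_mul_kronecker_mul_map {A : Type*} [Ring A] [Algebra K A] (P Q : M2 N K)
    (X : Matrix (Fin N) (Fin N) A) (p e q c : Fin N) :
    (P.map (algebraMap K A) * X ⊗ₖ (1 : Matrix (Fin N) (Fin N) A) * Q.map (algebraMap K A))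
        (p, e) (q, c) =
      ∑ x, ∑ z, algebraMap K A (∑ y, P (p, e) (x, y) * Q (z, y) (q, c)) * X x z := by
  simp only [Matrix.mul_apply, Matrix.map_apply, Matrix.kroneckerMap_apply, Matrix.one_apply,
    Fintype.sum_prod_type, mul_ite, mul_one, mul_zero, Finset.sum_ite_eq', Finset.mem_univ,
    if_true, Finset.sum_mul, map_sum, map_mul]
  refine Finset.sum_comm_cycle.trans (Finset.sum_congr rfl fun x _ =>
    Finset.sum_congr rfl fun z _ => Finset.sum_congr rfl fun y _ => ?_)
  rw [mul_assoc, ← Algebra.commutes, mul_assoc]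

/-- Quantum trace of a conjugated one-site operator with entries in a noncommutative algebra. -/
lemma IsClosedPair.sum_map_conj {F Ψ P Q : M2 N K} (h : IsClosedPair F Ψ)
    (hPQ : weightedTraceRight (Dmat Ψ)
      (actRight P * F ⊗ₖ (1 : Matrix (Fin N) (Fin N) K) * actRight Q) = 1)
    {A : Type*} [Ring A] [Algebra K A] (X : Matrix (Fin N) (Fin N) A) (p q : Fin N) :
    ∑ c, ∑ e, algebraMap K A (Dmat Ψ c e) *
        (P.map (algebraMap K A) * X ⊗ₖ (1 : Matrix (Fin N) (Fin N) A) * Q.map (algebraMap K A))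
          (p, e) (q, c) =
      if p = q then trF (Dmat Ψ) X else 0 := by
  have h1 : ∑ c, ∑ e, algebraMap K A (Dmat Ψ c e) *
        (P.map (algebraMap K A) * X ⊗ₖ (1 : Matrix (Fin N) (Fin N) A) * Q.map (algebraMap K A))
          (p, e) (q, c) =
      ∑ x, ∑ z, algebraMap K A
        (∑ c, ∑ e, Dmat Ψ c e * ∑ y, P (p, e) (x, y) * Q (z, y) (q, c)) * X x z := by
    simp only [map_mul_kronecker_mul_map, map_sum (algebraMap K A), map_mul, Finset.mul_sum,
      Finset.sum_mul, ← mul_assoc]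
    exact Finset.sum_comm_cycle.trans ((Finset.sum_congr rfl fun x _ =>
      Finset.sum_comm_cycle))
  rw [h1]
  simp only [h.sum_conj hPQ]
  split_ifs with hpq
  · exact Finset.sum_comm
  · simp

lemma IsClosedPair.weightedTraceRight_conj {F Ψ P Q : M2 N K} (h : IsClosedPair F Ψ)
    (hPQ : weightedTraceRight (Dmat Ψ)
      (actRight P * F ⊗ₖ (1 : Matrix (Fin N) (Fin N) K) * actRight Q) = 1)
    (X : Matrix (Fin N) (Fin N) K) :
    weightedTraceRight (Dmat Ψ) (P * X ⊗ₖ (1 : Matrix (Fin N) (Fin N) K) * Q) =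
      trF (Dmat Ψ) X • 1 := by
  ext p q
  have := h.sum_map_conj hPQ X p q
  simpa [weightedTraceRight, Matrix.one_apply, Matrix.map_id] using this

/-- If `F` is closed, the operators `X₁ F Y₁` separate points for the trace pairing. -/
lemma IsClosedPair.eq_zero_of_trace {F Ψ H : M2 N K} (h : IsClosedPair F Ψ)
    (hH : ∀ X Y : Matrix (Fin N) (Fin N) K,
      (X ⊗ₖ (1 : Matrix (Fin N) (Fin N) K) * F * Y ⊗ₖ (1 : Matrix (Fin N) (Fin N) K) *
        H).trace = 0) : H = 0 := by
  ext ⟨l, α⟩ ⟨i, γ⟩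
  have h1 (j k : Fin N) : ∑ b, ∑ d, F (j, b) (k, d) * H (l, d) (i, b) = 0 := by
    have := hH (Matrix.single i j 1) (Matrix.single k l 1)
    simpa [Matrix.trace, Matrix.mul_apply, Fintype.sum_prod_type, Matrix.one_apply,
      Matrix.single_apply, ite_and, Finset.sum_ite_irrel, Finset.sum_mul] using this
  have h2 := h.contract (fun b d => H (l, d) (i, b)) α γ
  simp only [h1, mul_zero, Finset.sum_const_zero] at h2
  exact h2.symm

lemma IsClosedPair.kronecker_Dmat_comm {F Ψ : M2 N K} (hF : IsUnit F) (hYB : YB F)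
    (h : IsClosedPair F Ψ) : F * Dmat Ψ ⊗ₖ Dmat Ψ = Dmat Ψ ⊗ₖ Dmat Ψ * F := by
  have hdet := (Matrix.isUnit_iff_isUnit_det F).mp hF
  have hFG := Matrix.mul_nonsing_inv F hdet
  have hGF := Matrix.nonsing_inv_mul F hdet
  obtain ⟨h1, h2⟩ := YB.weightedTraceRight_conj hF hYB h
  set D := Dmat Ψ
  set G := F⁻¹
  have hG : G * D ⊗ₖ D - D ⊗ₖ D * G = 0 := by
    refine h.eq_zero_of_trace fun X Y => ?_
    set U := X ⊗ₖ (1 : Matrix (Fin N) (Fin N) K)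
    set W := Y ⊗ₖ (1 : Matrix (Fin N) (Fin N) K)
    have e1 : (D ⊗ₖ D * (U * (F * W * G))).trace = trF D Y * (D * X).trace := by
      rw [trace_kronecker_mul, weightedTraceRight_kronecker_mul, h.weightedTraceRight_conj h1,
        ← mul_assoc, Matrix.mul_smul, mul_one, Matrix.trace_smul, smul_eq_mul]
    have e2 : (D ⊗ₖ D * (G * U * F * W)).trace = trF D X * (D * Y).trace := by
      rw [trace_kronecker_mul, weightedTraceRight_mul_kronecker, h.weightedTraceRight_conj h2,
        Matrix.smul_mul, one_mul, Matrix.mul_smul, Matrix.trace_smul, smul_eq_mul]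
    have e3 (Z : Matrix (Fin N) (Fin N) K) : trF D Z = (D * Z).trace := by
      simp [trF, Matrix.trace, Matrix.mul_apply]
    rw [mul_sub, Matrix.trace_sub, sub_eq_zero]
    calc (U * F * W * (G * D ⊗ₖ D)).trace = (D ⊗ₖ D * (U * (F * W * G))).trace := by
          rw [Matrix.trace_mul_comm (D ⊗ₖ D)]; simp only [mul_assoc]
      _ = (D ⊗ₖ D * (G * U * F * W)).trace := by rw [e1, e2, e3, e3, mul_comm]
      _ = _ := by rw [Matrix.trace_mul_comm (U * F * W)]; simp only [mul_assoc]
  rw [sub_eq_zero] at hG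
  calc F * D ⊗ₖ D = F * (D ⊗ₖ D * G) * F := by simp only [mul_assoc, hGF, mul_one]
    _ = D ⊗ₖ D * F := by rw [← hG]; simp only [← mul_assoc, hFG, one_mul]

lemma one_apply_finOne {A : Type*} [Ring A] (a b : Fin 1 → Fin N) :
    (1 : Op N A 1) a b = if a 0 = b 0 then 1 else 0 := by
  simp [Matrix.one_apply, funext_iff]

lemma IsClosedPair.qtr1_conj {F Ψ P Q : M2 N K} (h : IsClosedPair F Ψ)
    (hPQ : weightedTraceRight (Dmat Ψ)
      (actRight P * F ⊗ₖ (1 : Matrix (Fin N) (Fin N) K) * actRight Q) = 1)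
    {A : Type*} [Ring A] [Algebra K A] (X : Matrix (Fin N) (Fin N) A) :
    qtr1 (Dmat Ψ) (site 2 0 (P.map (algebraMap K A)) * site1 2 0 X *
        site 2 0 (Q.map (algebraMap K A))) = trF (Dmat Ψ) X • (1 : Op N A 1) := by
  ext a b
  simp only [qtr1_apply_finTwo, ← Matrix.submatrix_mul_equiv _ _ _ (finTwoIndex N) _,
    site_two_submatrix, site1_two_zero_submatrix, h.sum_map_conj hPQ, Matrix.smul_apply,
    one_apply_finOne, smul_eq_mul, mul_ite, mul_one, mul_zero]

end Closed

/-- For a closed R-matrix `F̂` satisfying the Yang–Baxter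
equation, with closedness witness `Ψ` and `D = Dmat Ψ`:
(i) `Tr_F(2) F̂₁ = I`;  (ii) `F̂₁D₁D₂ = D₁D₂F̂₁` on `V⊗V`;  (iii) for any unital
associative `K`-algebra `A` and any `N×N` matrix `X` over `A`,
`Tr_F(2)(F̂₁^{±1} X₁ F̂₁^{∓1}) = I ⬝ Tr_F X`. -/
theorem closed_D_properties {K : Type} [Field K] {N : ℕ}
    (F Ψ : M2 N K) (hF : IsUnit F) (hYB : YB F) (hΨ : IsClosedPair F Ψ) :
    qtr1 (Dmat Ψ) (site 2 0 F) = (1 : Op N K 1) ∧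
    site 2 0 F * site1 2 0 (Dmat Ψ) * site1 2 1 (Dmat Ψ) =
      site1 2 0 (Dmat Ψ) * site1 2 1 (Dmat Ψ) * site 2 0 F ∧
    (∀ (A : Type) [Ring A] [Algebra K A] (X : Matrix (Fin N) (Fin N) A),
      qtr1 (Dmat Ψ)
          (site 2 0 (F.map (algebraMap K A)) * site1 2 0 X *
            site 2 0 ((F⁻¹).map (algebraMap K A))) =
        trF (Dmat Ψ) X • (1 : Op N A 1) ∧
      qtr1 (Dmat Ψ)
          (site 2 0 ((F⁻¹).map (algebraMap K A)) * site1 2 0 X *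
            site 2 0 (F.map (algebraMap K A))) =
        trF (Dmat Ψ) X • (1 : Op N A 1)) := by
  obtain ⟨h1, h2⟩ := YB.weightedTraceRight_conj hF hYB hΨ
  refine ⟨?_, ?_, fun A _ _ X => ⟨hΨ.qtr1_conj h1 X, hΨ.qtr1_conj h2 X⟩⟩
  · ext a b
    rw [qtr1_apply_finTwo, site_two_submatrix, one_apply_finOne]
    exact congrFun (congrFun hΨ.weightedTraceRight_eq_one (a 0)) (b 0)
  · apply (Matrix.reindex (finTwoIndex N).symm (finTwoIndex N).symm).injective
    simp only [Matrix.reindex_apply, Equiv.symm_symm,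
      ← Matrix.submatrix_mul_equiv _ _ _ (finTwoIndex N) _, site_two_submatrix,
      site1_two_zero_submatrix, site1_two_one_submatrix]
    rw [mul_assoc, ← Matrix.mul_kronecker_mul, mul_one, one_mul]
    exact hΨ.kronecker_Dmat_comm hF hYB

end CHN
end

section
/- Let R̂ and F̂ be compatible R-matrices, A a unital associative k-algebra, and M an arbitrary N×N matrix over A (N = dim V), with the copies M_{k̄} defined recursively by M_{1̄} := M₁ and M_{(k+1)‾} := F̂_k M_{k̄} F̂_k^{-1}. Then for all indices with k ≠ i and k ≠ i+1 one has F̂_i M_{k̄} = M_{k̄} F̂_i and R̂_i M_{k̄} = M_{k̄} R̂_i. -/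
/-! Common definitions for quantum matrix algebras `M(R̂,F̂)` in the sense of
Isaev–Ogievetsky–Pyatov, "On quantum matrix algebras satisfying the
Cayley-Hamilton-Newton identities".

We model operators on `V^{⊗m}` (where `dim V = N`) as matrices indexed by
multi-indices `Fin m → Fin N`; entries are taken in a (possibly
noncommutative) unital associative algebra `A` over a field `K`.
Sites (tensor factors) are numbered starting from `0`, so the paper's
`X_i` is `site m (i-1) X`, and the paper's `M_{\overline{k}}` is
`Mbar m F F⁻¹ M (k-1)`. -/

namespace CHN

/-- `embed f X` lets an operator `X` on `V^{⊗ι}` act on the tensor factors of `V^{⊗κ}`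
selected by `f : ι → κ`, as the identity elsewhere. -/
noncomputable def embed {A ι κ α : Type*} [Ring A] (f : ι → κ) (X : Matrix (ι → α) (ι → α) A) :
    Matrix (κ → α) (κ → α) A :=
  open Classical in
  fun a b => X (a ∘ f) (b ∘ f) * if ∀ j ∉ Set.range f, a j = b j then 1 else 0

section Embed

variable {A ι κ α : Type*} [Ring A] {f : ι → κ}

theorem embed_one [DecidableEq (ι → α)] [DecidableEq (κ → α)] :
    embed f (1 : Matrix (ι → α) (ι → α) A) = 1 := by
  classical
  ext a b
  have key : a = b ↔ a ∘ f = b ∘ f ∧ ∀ j ∉ Set.range f, a j = b j := by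
    refine ⟨fun h => by simp [h], fun ⟨h₁, h₂⟩ => funext fun j => ?_⟩
    by_cases hj : j ∈ Set.range f
    · obtain ⟨t, rfl⟩ := hj
      exact congrFun h₁ t
    · exact h₂ j hj
  simp only [embed, Matrix.one_apply, key, mul_ite, mul_one, mul_zero, ite_and]
  split_ifs <;> rfl

theorem embed_mul [Fintype (ι → α)] [Fintype (κ → α)] (hf : f.Injective)
    (X Y : Matrix (ι → α) (ι → α) A) : embed f (X * Y) = embed f X * embed f Y := by
  classical
  ext a b
  have hoff (c : ι → α) (j : κ) (hj : j ∉ Set.range f) : Function.extend f c a j = a j :=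
    Function.extend_apply' _ _ _ fun ⟨t, ht⟩ => hj ⟨t, ht⟩
  simp only [embed, Matrix.mul_apply, Finset.sum_mul]
  refine Fintype.sum_of_injective (fun c => Function.extend f c a)
    (fun c d h => ?_) _ _ (fun c hc => ?_) fun c => ?_
  · simpa [Function.extend_comp hf] using congrArg (· ∘ f) h
  · rw [if_neg, mul_zero, zero_mul]
    refine fun h => hc ⟨c ∘ f, funext fun j => ?_⟩
    by_cases hj : j ∈ Set.range f
    · obtain ⟨t, rfl⟩ := hj
      exact hf.extend_apply _ _ _
    · exact (hoff _ j hj).trans (h j hj)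
  · have h₁ : (∀ j ∉ Set.range f, a j = Function.extend f c a j) :=
      fun j hj => (hoff c j hj).symm
    have h₂ : (∀ j ∉ Set.range f, Function.extend f c a j = b j) ↔
        ∀ j ∉ Set.range f, a j = b j :=
      forall₂_congr fun j hj => by rw [hoff c j hj]
    simp only [Function.extend_comp hf, if_pos h₁, h₂, mul_one, mul_assoc]

theorem embed_mul_embed_apply {ι' : Type*} {g : ι' → κ} [Fintype (κ → α)] (hf : f.Injective)
    (hfg : Disjoint (Set.range f) (Set.range g))
    (X : Matrix (ι → α) (ι → α) A) (Y : Matrix (ι' → α) (ι' → α) A) (a b : κ → α) :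
    (embed f X * embed g Y) a b = open Classical in
      if ∀ j, j ∉ Set.range f → j ∉ Set.range g → a j = b j then
        X (a ∘ f) (b ∘ f) * Y (a ∘ g) (b ∘ g) else 0 := by
  classical
  set c : κ → α := Function.extend f (b ∘ f) a with hc
  have hon : c ∘ f = b ∘ f := Function.extend_comp hf _ _
  have hoff (j : κ) (hj : j ∉ Set.range f) : c j = a j :=
    Function.extend_apply' _ _ _ fun ⟨t, ht⟩ => hj ⟨t, ht⟩
  have hg : c ∘ g = a ∘ g := funext fun t =>
    hoff _ fun h => Set.disjoint_left.1 hfg h ⟨t, rfl⟩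
  rw [Matrix.mul_apply, Fintype.sum_eq_single c]
  · have h₁ : ∀ j ∉ Set.range f, a j = c j := fun j hj => (hoff j hj).symm
    have h₂ : (∀ j ∉ Set.range g, c j = b j) ↔
        ∀ j, j ∉ Set.range f → j ∉ Set.range g → a j = b j := by
      refine ⟨fun h j hjf hjg => (h₁ j hjf).trans (h j hjg), fun h j hjg => ?_⟩
      by_cases hj : j ∈ Set.range f
      · obtain ⟨t, rfl⟩ := hj
        exact congrFun hon t
      · exact (hoff j hj).trans (h j hj hjg)
    simp only [embed, hon, hg, if_pos h₁, h₂, mul_one, mul_ite, mul_zero]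
  · intro d hd
    by_cases h₁ : ∀ j ∉ Set.range f, a j = d j
    · have h₂ : ¬ ∀ j ∉ Set.range g, d j = b j := by
        refine fun h => hd (funext fun j => ?_)
        by_cases hj : j ∈ Set.range f
        · obtain ⟨t, rfl⟩ := hj
          exact (h _ (Set.disjoint_left.1 hfg ⟨t, rfl⟩)).trans (congrFun hon t).symm
        · exact (h₁ j hj).symm.trans (hoff j hj).symm
      simp only [embed, if_neg h₂, mul_zero]
    · simp only [embed, if_neg h₁, mul_zero, zero_mul]

theorem commute_embed {ι' : Type*} {g : ι' → κ} [Fintype (κ → α)] (hf : f.Injective)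
    (hg : g.Injective) (hfg : Disjoint (Set.range f) (Set.range g))
    {X : Matrix (ι → α) (ι → α) A} {Y : Matrix (ι' → α) (ι' → α) A}
    (h : ∀ p q r s, Commute (X p q) (Y r s)) : Commute (embed f X) (embed g Y) := by
  ext a b
  rw [embed_mul_embed_apply hf hfg, embed_mul_embed_apply hg hfg.symm]
  congr 1
  · exact propext ⟨fun H j h₁ h₂ => H j h₂ h₁, fun H j h₁ h₂ => H j h₂ h₁⟩
  · exact h _ _ _ _

end Embed

section Site

variable {A : Type*} [Ring A] {N : ℕ}

/-- The inclusion of `n` consecutive tensor factors starting at the factor `i`. -/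
def shift {n m : ℕ} (i : ℕ) (h : i + n ≤ m) (t : Fin n) : Fin m := ⟨i + t, by omega⟩

theorem shift_injective {n m i : ℕ} (h : i + n ≤ m) : (shift i h).Injective :=
  fun s t hst => by simpa [shift, Fin.ext_iff] using hst

theorem mem_range_shift {n m i : ℕ} (h : i + n ≤ m) (j : Fin m) :
    j ∈ Set.range (shift i h) ↔ i ≤ j ∧ (j : ℕ) < i + n := by
  constructor
  · rintro ⟨t, rfl⟩
    simp [shift]
  · exact fun hj => ⟨⟨j - i, by omega⟩, Fin.ext (by simp [shift]; omega)⟩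

theorem disjoint_range_shift {n n' m i i' : ℕ} (h : i + n ≤ m) (h' : i' + n' ≤ m)
    (hd : i + n ≤ i' ∨ i' + n' ≤ i) :
    Disjoint (Set.range (shift i h)) (Set.range (shift i' h')) :=
  Set.disjoint_left.2 fun j hj hj' => by
    rw [mem_range_shift] at hj hj'
    omega

theorem site_add {n m i s : ℕ} (h : i + n ≤ m) (hs : s + 1 < n) (X : M2 N A) :
    site m (i + s) X = embed (shift i h) (site n s X) := by
  classical
  ext a b
  have hm : i + s + 1 < m := by omega
  have key : (∀ j : Fin m, (j : ℕ) ≠ i + s → (j : ℕ) ≠ i + s + 1 → a j = b j) ↔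
      (∀ j ∉ Set.range (shift i h), a j = b j) ∧
      ∀ t : Fin n, (t : ℕ) ≠ s → (t : ℕ) ≠ s + 1 →
        (a ∘ shift i h) t = (b ∘ shift i h) t := by
    refine ⟨fun H => ⟨fun j hj => H j ?_ ?_, fun t h₁ h₂ => H _ ?_ ?_⟩, fun ⟨H₁, H₂⟩ j h₁ h₂ => ?_⟩
    · rw [mem_range_shift] at hj; omega
    · rw [mem_range_shift] at hj; omega
    · simp only [shift]; omega
    · simp only [shift]; omega
    · by_cases hj : j ∈ Set.range (shift i h)
      · obtain ⟨t, rfl⟩ := hj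
        simp only [shift] at h₁ h₂
        exact H₂ t (by omega) (by omega)
      · exact H₁ j hj
  simp only [site, embed, dif_pos hm, dif_pos hs, key, ite_and, mul_ite, mul_one, mul_zero]
  rfl

theorem site_eq_embed {m i : ℕ} (h : i + 2 ≤ m) (X : M2 N A) :
    site m i X = embed (shift i h) (site 2 0 X) :=
  site_add (s := 0) h (by omega) X

theorem site1_zero_eq_embed {m : ℕ} (h : 0 + 1 ≤ m) (X : Matrix (Fin N) (Fin N) A) :
    site1 m 0 X = embed (shift 0 h) (site1 1 0 X) := by
  classical
  ext a b
  have key : (∀ j : Fin m, (j : ℕ) ≠ 0 → a j = b j) ↔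
      ∀ j ∉ Set.range (shift 0 h), a j = b j :=
    forall_congr' fun j => by rw [mem_range_shift]; simp
  have h' : 0 < m := h
  simp only [site1, embed, dif_pos h', key]
  simp [shift]

theorem site_two_zero (X : M2 N A) :
    site 2 0 X = X.submatrix (finTwoArrowEquiv (Fin N)) (finTwoArrowEquiv (Fin N)) := by
  ext a b
  simp [site, Fin.forall_fin_two]

theorem site_mul {m i : ℕ} (h : i + 1 < m) (X Y : M2 N A) :
    site m i (X * Y) = site m i X * site m i Y := by
  simp only [site_eq_embed (show i + 2 ≤ m from h)]
  rw [← embed_mul (shift_injective _), site_two_zero, site_two_zero, site_two_zero,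
    Matrix.submatrix_mul_equiv]

theorem site_one {m i : ℕ} (h : i + 1 < m) : site m i (1 : M2 N A) = 1 := by
  rw [site_eq_embed (show i + 2 ≤ m from h), site_two_zero, Matrix.submatrix_one_equiv, embed_one]

theorem commute_site_site {m i j : ℕ} (hi : i + 1 < m) (hj : j + 1 < m)
    (hij : i + 2 ≤ j ∨ j + 2 ≤ i) {X Y : M2 N A}
    (h : ∀ p q r s, Commute (X p q) (Y r s)) : Commute (site m i X) (site m j Y) := by
  rw [site_eq_embed (show i + 2 ≤ m from hi), site_eq_embed (show j + 2 ≤ m from hj)]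
  refine commute_embed (shift_injective _) (shift_injective _) (disjoint_range_shift _ _ hij) ?_
  simp only [site_two_zero]
  exact fun _ _ _ _ => h _ _ _ _

theorem commute_site_site1_zero {m i : ℕ} (hi : i + 1 < m) (h0 : i ≠ 0) {X : M2 N A}
    {M : Matrix (Fin N) (Fin N) A} (h : ∀ p q r s, Commute (X p q) (M r s)) :
    Commute (site m i X) (site1 m 0 M) := by
  rw [site_eq_embed (show i + 2 ≤ m from hi), site1_zero_eq_embed (show 0 + 1 ≤ m by omega)]
  refine commute_embed (shift_injective _) (shift_injective _)
    (disjoint_range_shift _ _ (by omega)) fun p q r s => ?_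
  simpa [site_two_zero, site1] using h _ _ _ _

theorem site_map {B : Type*} [Ring B] (φ : A →+* B) (m i : ℕ) (X : M2 N A) :
    site m i (X.map φ) = (site m i X).map φ := by
  ext a b
  simp only [site, Matrix.map_apply]
  split_ifs <;> simp

theorem semiconjBy_site {X F : M2 N A}
    (h : SemiconjBy (site 3 1 F * site 3 0 F) (site 3 1 X) (site 3 0 X)) {m i : ℕ}
    (hi : i + 2 < m) :
    SemiconjBy (site m (i + 1) F * site m i F) (site m (i + 1) X) (site m i X) := by
  have h₁ (Y : M2 N A) : site m (i + 1) Y = embed (shift i hi) (site 3 1 Y) :=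
    site_add hi (by omega) Y
  have h₀ (Y : M2 N A) : site m i Y = embed (shift i hi) (site 3 0 Y) :=
    site_add (s := 0) hi (by omega) Y
  simp only [SemiconjBy, h₀, h₁, ← embed_mul (shift_injective _)] at h ⊢
  rw [h]

/-- An operator `X` with `X₁F₂F₁ = F₂F₁X₂` whose entries are scalars commutes with all the
copies of `M` which do not involve the factors it acts on. -/
theorem commute_site_Mbar {X F G : M2 N A} (M : Matrix (Fin N) (Fin N) A)
    (hXc : ∀ p q y, Commute (X p q) y) (hFG : F * G = 1) (hGF : G * F = 1)
    (h : SemiconjBy (site 3 1 F * site 3 0 F) (site 3 1 X) (site 3 0 X)) {m : ℕ} (k i : ℕ)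
    (hi : i + 1 < m) (hk : k < m) (hki : k ≠ i) (hki' : k ≠ i + 1) :
    Commute (site m i X) (Mbar m F G M k) := by
  induction k using Nat.strong_induction_on generalizing i with
  | _ k ih =>
    rcases k with _ | k
    · exact commute_site_site1_zero hi hki.symm fun _ _ _ _ => hXc _ _ _
    · have hinv {j : ℕ} (hj : j + 1 < m) :
          site m j F * site m j G = 1 ∧ site m j G * site m j F = 1 := by
        simp only [← site_mul hj, hFG, hGF, site_one hj, and_self]
      by_cases hk' : k = i + 1
      · subst hk'
        obtain ⟨hFG₀, hGF₀⟩ := hinv (j := i) (by omega)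
        obtain ⟨hFG₁, hGF₁⟩ := hinv (j := i + 1) (by omega)
        let u : (Op N A m)ˣ :=
          ⟨site m (i + 1) F, site m (i + 1) G, hFG₁, hGF₁⟩ * ⟨site m i F, site m i G, hFG₀, hGF₀⟩
        have hu : SemiconjBy (u : Op N A m) (site m (i + 1) X) (site m i X) :=
          semiconjBy_site h (by omega)
        have hM : Commute (site m (i + 1) X) (Mbar m F G M i) :=
          ih i (by omega) (i + 1) (by omega) (by omega) (by omega) (by omega)
        have hMbar : Mbar m F G M (i + 1 + 1) =
            (u : Op N A m) * Mbar m F G M i * ((u⁻¹ : (Op N A m)ˣ) : Op N A m) := by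
          simp [Mbar, u, mul_assoc]
        rw [hMbar]
        exact Commute.symm
          ((hu.mul_left hM.symm).mul_left hu.units_inv_symm_left)
      · have hfar (Y : M2 N A) : Commute (site m i X) (site m k Y) :=
          commute_site_site hi hk (by omega) fun _ _ _ _ => hXc _ _ _
        exact ((hfar F).mul_right (ih k (by omega) i hi (by omega) (by omega) (by omega))).mul_right
          (hfar G)

end Site

/-- Lemma a, (13)–(14).  For compatible R-matrices `R̂, F̂` and an
arbitrary matrix `M` over `A`, one has `F̂_i M_{\overline{k}} = M_{\overline{k}} F̂_i`
and `R̂_i M_{\overline{k}} = M_{\overline{k}} R̂_i` whenever `k ≠ i, i+1`.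
(Here all indices are 0-based:  `site m i _` is the paper's `F̂_{i+1}` and
`Mbar m _ _ M k` is the paper's `M_{\overline{k+1}}`; the in-range conditions
`i + 1 < m`, `k < m` say that all the operators involved really act on `V^{⊗m}`.) -/
theorem F_R_commute_with_Mbar {K : Type} [Field K] {A : Type} [Ring A] [Algebra K A]
    {N : ℕ} (R F : M2 N K) (hR : IsUnit R) (hF : IsUnit F) (h : Compatible R F)
    (M : Matrix (Fin N) (Fin N) A) :
    ∀ m i k : ℕ, i + 1 < m → k < m → k ≠ i → k ≠ i + 1 →
      site m i (F.map (algebraMap K A)) *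
          Mbar m (F.map (algebraMap K A)) ((F⁻¹).map (algebraMap K A)) M k =
        Mbar m (F.map (algebraMap K A)) ((F⁻¹).map (algebraMap K A)) M k *
          site m i (F.map (algebraMap K A)) ∧
      site m i (R.map (algebraMap K A)) *
          Mbar m (F.map (algebraMap K A)) ((F⁻¹).map (algebraMap K A)) M k =
        Mbar m (F.map (algebraMap K A)) ((F⁻¹).map (algebraMap K A)) M k *
          site m i (R.map (algebraMap K A)) := by
  intro m i k hi hk hki hki'
  have hdet := (Matrix.isUnit_iff_isUnit_det F).1 hF
  have hFG : F.map (algebraMap K A) * (F⁻¹).map (algebraMap K A) = 1 := by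
    rw [← Matrix.map_mul, Matrix.mul_nonsing_inv _ hdet]
    simp
  have hGF : (F⁻¹).map (algebraMap K A) * F.map (algebraMap K A) = 1 := by
    rw [← Matrix.map_mul, Matrix.nonsing_inv_mul _ hdet]
    simp
  have key (X : M2 N K)
      (hX : site 3 0 X * site 3 1 F * site 3 0 F = site 3 1 F * site 3 0 F * site 3 1 X) :
      Commute (site m i (X.map (algebraMap K A)))
        (Mbar m (F.map (algebraMap K A)) ((F⁻¹).map (algebraMap K A)) M k) := by
    refine commute_site_Mbar (X := X.map (algebraMap K A)) M (fun _ _ _ => Algebra.commutes _ _)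
      hFG hGF ?_ k i hi hk hki hki'
    rw [SemiconjBy, site_map, site_map, site_map, site_map, ← Matrix.map_mul, ← Matrix.map_mul,
      ← Matrix.map_mul, ← hX, mul_assoc]
  exact ⟨key F h.2.1, key R h.2.2.1⟩

end CHN
end
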